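/- Let Ω be a differential 2-form of rank 4 on a smooth 4-dimensional manifold M with dΩ ≠ 0 (nowhere vanishing on the region considered). Then dω_Ω ∧ dφ_Ω = −(1/2)·Z_Ω(I(Ω))·Ω∧Ω. -/

import Mathlib

/-!  Coordinate formalization of differential forms in four variables,
     following "The equivalence problem of differential 2-forms in 4 variables". -/

open Real Filter

/-- Points of `ℝ⁴`; the coordinates `x¹, x², x³, x⁴` of the paper are `x 0, x 1, x 2, x 3`. -/
abbrev Pt := Fin 4 → ℝ

/-- Partial derivative `∂f/∂xⁱ`. -/
noncomputable def pd (i : Fin 4) (f : Pt → ℝ) (x : Pt) : ℝ :=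
  fderiv ℝ f x (Pi.single i 1)

/-- Second partial derivative `∂²f/∂xⁱ∂xʲ`. -/
noncomputable def pd2 (i j : Fin 4) (f : Pt → ℝ) (x : Pt) : ℝ :=
  pd i (fun y => pd j f y) x

/-- Differential forms of degree 0,1,2,3,4 on `ℝ⁴`, given by their (skew-symmetric)
    coordinate components, and vector fields. -/
abbrev Form0 := Pt → ℝ
abbrev Form1 := Pt → Fin 4 → ℝ
abbrev Form2 := Pt → Fin 4 → Fin 4 → ℝ
abbrev Form3 := Pt → Fin 4 → Fin 4 → Fin 4 → ℝ
abbrev Form4 := Pt → Fin 4 → Fin 4 → Fin 4 → Fin 4 → ℝ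
abbrev Vec := Pt → Fin 4 → ℝ

/-- A 2-form has skew-symmetric components. -/
def Alt2 (B : Form2) : Prop := ∀ x i j, B x i j = - B x j i

/-- Exterior derivative of a function. -/
noncomputable def d0 (f : Form0) : Form1 := fun x i => pd i f x

/-- Exterior derivative of a 1-form. -/
noncomputable def d1 (ω : Form1) : Form2 := fun x i j =>
  pd i (fun y => ω y j) x - pd j (fun y => ω y i) x

/-- Exterior derivative of a 2-form. -/
noncomputable def d2 (B : Form2) : Form3 := fun x i j k =>
  pd i (fun y => B y j k) x - pd j (fun y => B y i k) x + pd k (fun y => B y i j) x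

/-- Wedge product of two 1-forms. -/
def w11 (ω η : Form1) : Form2 := fun x i j => ω x i * η x j - ω x j * η x i

/-- Wedge product of a 1-form and a 2-form. -/
def w12 (ω : Form1) (B : Form2) : Form3 := fun x i j k =>
  ω x i * B x j k - ω x j * B x i k + ω x k * B x i j

/-- Wedge product of a 1-form and a 3-form. -/
def w13 (ω : Form1) (C : Form3) : Form4 := fun x i j k l =>
  ω x i * C x j k l - ω x j * C x i k l + ω x k * C x i j l - ω x l * C x i j k

/-- Wedge product of two 2-forms. -/
def w22 (A B : Form2) : Form4 := fun x i j k l =>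
  A x i j * B x k l - A x i k * B x j l + A x i l * B x j k
    + A x j k * B x i l - A x j l * B x i k + A x k l * B x i j

/-- A 2-form is of rank 4 when `Ω ∧ Ω` vanishes nowhere. -/
def Rank4 (B : Form2) : Prop := ∀ x, w22 B B x ≠ 0

/-- Interior products `i_X`. -/
def i1 (X : Vec) (ω : Form1) : Form0 := fun x => ∑ i, X x i * ω x i
def i2 (X : Vec) (B : Form2) : Form1 := fun x j => ∑ i, X x i * B x i j
def i3 (X : Vec) (C : Form3) : Form2 := fun x j k => ∑ i, X x i * C x i j k
def i4 (X : Vec) (D : Form4) : Form3 := fun x j k l => ∑ i, X x i * D x i j k l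

/-- Evaluation `B(X,Y)` of a 2-form on two vector fields. -/
def ev2 (B : Form2) (X Y : Vec) : Form0 := fun x => ∑ i, ∑ j, X x i * Y x j * B x i j

/-- Evaluation `D(X,Y,Z,W)` of a 4-form on four vector fields. -/
def ev4 (D : Form4) (X Y Z W : Vec) : Form0 := fun x =>
  ∑ i, ∑ j, ∑ k, ∑ l, X x i * Y x j * Z x k * W x l * D x i j k l

/-- Lie derivative of a 1-form (Cartan's magic formula). -/
noncomputable def lie1 (X : Vec) (ω : Form1) : Form1 := fun x i =>
  d0 (i1 X ω) x i + i2 X (d1 ω) x i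

/-- Lie derivative of a 2-form (Cartan's magic formula). -/
noncomputable def lie2 (X : Vec) (B : Form2) : Form2 := fun x i j =>
  d1 (i2 X B) x i j + i3 X (d2 B) x i j

/-- Lie bracket of two vector fields. -/
noncomputable def bracket (X Y : Vec) : Vec := fun x i =>
  ∑ j, (X x j * pd j (fun y => Y y i) x - Y x j * pd j (fun y => X y i) x)

/-- Derivative `X(f)` of a function along a vector field. -/
noncomputable def dirDeriv (X : Vec) (f : Form0) : Form0 := fun x => ∑ j, X x j * pd j f x

/-- Pullback of a 1-form under a smooth map. -/
noncomputable def pull1 (φ : Pt → Pt) (ω : Form1) : Form1 := fun x i =>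
  ∑ a, ω (φ x) a * pd i (fun y => φ y a) x

/-- Pullback of a 2-form under a smooth map. -/
noncomputable def pull2 (φ : Pt → Pt) (B : Form2) : Form2 := fun x i j =>
  ∑ a, ∑ b, B (φ x) a b * pd i (fun y => φ y a) x * pd j (fun y => φ y b) x

/-- A pair of mutually inverse smooth maps: a diffeomorphism of `ℝ⁴` (with inverse). -/
def IsDiffeo (φ ψ : Pt → Pt) : Prop :=
  ContDiff ℝ (⊤ : ℕ∞) φ ∧ ContDiff ℝ (⊤ : ℕ∞) ψ ∧ (∀ x, ψ (φ x) = x) ∧ (∀ x, φ (ψ x) = x)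

/-- The covector with components `c` as a linear functional on the tangent space `ℝ⁴`. -/
noncomputable def covec (c : Fin 4 → ℝ) : Pt →ₗ[ℝ] ℝ :=
  ∑ i, c i • (LinearMap.proj i : Pt →ₗ[ℝ] ℝ)

/-- The class of a 1-form `ω` at `x`: the codimension of the space of tangent vectors `v`
    with `i_v ω = 0` and `i_v (dω) = 0`. -/
noncomputable def classAt (ω : Form1) (x : Pt) : ℕ :=
  4 - Module.finrank ℝ
    ↥(LinearMap.ker (covec (ω x)) ⊓ ⨅ j, LinearMap.ker (covec (fun i => d1 ω x i j)))

/-- Components of the constant 2-form `dxᵃ ∧ dxᵇ`. -/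
def dxw (a b : Fin 4) : Fin 4 → Fin 4 → ℝ := fun i j =>
  (if i = a ∧ j = b then (1:ℝ) else 0) - (if i = b ∧ j = a then (1:ℝ) else 0)

/-- A germ of 2-form (with associated 1-form `ω = ω_Ω`) is of type `t` at `x₀`:
    `ω` is nonsingular at `x₀` and of constant class `t` near `x₀`. -/
def IsTypeAt (ω : Form1) (t : ℕ) (x₀ : Pt) : Prop :=
  ω x₀ ≠ 0 ∧ ∀ᶠ x in nhds x₀, classAt ω x = t

/-- Exterior derivative of a 3-form, component `0123`. -/
noncomputable def d3c (C : Form3) (x : Pt) : ℝ :=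
  pd 0 (fun y => C y 1 2 3) x - pd 1 (fun y => C y 0 2 3) x
    + pd 2 (fun y => C y 0 1 3) x - pd 3 (fun y => C y 0 1 2) x

theorem pd_add' (i : Fin 4) (f g : Pt → ℝ) (hf : Differentiable ℝ f) (hg : Differentiable ℝ g)
    (x : Pt) : pd i (fun y => f y + g y) x = pd i f x + pd i g x := by
  unfold pd; rw [fderiv_fun_add (hf x) (hg x)]; rfl

theorem pd_sub' (i : Fin 4) (f g : Pt → ℝ) (hf : Differentiable ℝ f) (hg : Differentiable ℝ g)
    (x : Pt) : pd i (fun y => f y - g y) x = pd i f x - pd i g x := by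
  unfold pd; rw [fderiv_fun_sub (hf x) (hg x)]; rfl

theorem pd_neg' (i : Fin 4) (f : Pt → ℝ) (x : Pt) : pd i (fun y => - f y) x = - pd i f x := by
  unfold pd; rw [fderiv_fun_neg]; rfl

theorem pd_mul' (i : Fin 4) (f g : Pt → ℝ) (hf : Differentiable ℝ f) (hg : Differentiable ℝ g)
    (x : Pt) : pd i (fun y => f y * g y) x = f x * pd i g x + g x * pd i f x := by
  unfold pd; rw [fderiv_fun_mul (hf x) (hg x)]; simp

theorem pd_smooth (i : Fin 4) (f : Pt → ℝ) (hf : ContDiff ℝ (⊤ : ℕ∞) f) :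
    ContDiff ℝ (⊤ : ℕ∞) (fun y => pd i f y) := by
  unfold pd
  exact (hf.fderiv_right (m := (⊤ : ℕ∞)) (by norm_cast)).clm_apply contDiff_const

theorem smooth_diff (f : Pt → ℝ) (hf : ContDiff ℝ (⊤ : ℕ∞) f) : Differentiable ℝ f :=
  hf.differentiable (by simp)

theorem pd_comm' (i j : Fin 4) (f : Pt → ℝ) (hf : ContDiff ℝ (⊤ : ℕ∞) f) (x : Pt) :
    pd i (fun y => pd j f y) x = pd j (fun y => pd i f y) x := by
  have hs : IsSymmSndFDerivAt ℝ f x :=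
    hf.contDiffAt.isSymmSndFDerivAt (by simp; norm_cast)
  have hd : DifferentiableAt ℝ (fderiv ℝ f) x :=
    ((hf.fderiv_right (m := (⊤ : ℕ∞)) (by norm_cast)).differentiable (by simp)) x
  unfold pd
  rw [fderiv_clm_apply hd (by fun_prop), fderiv_clm_apply hd (by fun_prop)]
  simpa using hs.eq (Pi.single i 1) (Pi.single j 1)

theorem c1 (α : Form1) (h : ContDiff ℝ (⊤ : ℕ∞) α) (i : Fin 4) :
    ContDiff ℝ (⊤ : ℕ∞) (fun y => α y i) := (contDiff_pi.1 h) i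

theorem c2 (B : Form2) (h : ContDiff ℝ (⊤ : ℕ∞) B) (i j : Fin 4) :
    ContDiff ℝ (⊤ : ℕ∞) (fun y => B y i j) := (contDiff_pi.1 ((contDiff_pi.1 h) i)) j

theorem d1_smooth (α : Form1) (h : ContDiff ℝ (⊤ : ℕ∞) α) : ContDiff ℝ (⊤ : ℕ∞) (d1 α) := by
  refine contDiff_pi.2 fun i => contDiff_pi.2 fun j => ?_
  exact (pd_smooth i _ (c1 α h j)).sub (pd_smooth j _ (c1 α h i))

theorem d3c_w12 (α : Form1) (B : Form2) (hα : ContDiff ℝ (⊤ : ℕ∞) α)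
    (hB : ContDiff ℝ (⊤ : ℕ∞) B) (x : Pt) :
    d3c (w12 α B) x = w22 (d1 α) B x 0 1 2 3 - w13 α (d2 B) x 0 1 2 3 := by
  have a : ∀ i, Differentiable ℝ (fun y => α y i) := fun i => smooth_diff _ (c1 α hα i)
  have b : ∀ i j, Differentiable ℝ (fun y => B y i j) := fun i j => smooth_diff _ (c2 B hB i j)
  have key : ∀ m i j k, pd m (fun y => w12 α B y i j k) x =
      (α x i * pd m (fun y => B y j k) x + B x j k * pd m (fun y => α y i) x)
      - (α x j * pd m (fun y => B y i k) x + B x i k * pd m (fun y => α y j) x)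
      + (α x k * pd m (fun y => B y i j) x + B x i j * pd m (fun y => α y k) x) := by
    intro m i j k
    unfold w12
    rw [pd_add' m (fun y => α y i * B y j k - α y j * B y i k) (fun y => α y k * B y i j)
        (((a i).mul (b j k)).sub ((a j).mul (b i k))) ((a k).mul (b i j)),
      pd_sub' m (fun y => α y i * B y j k) (fun y => α y j * B y i k)
        ((a i).mul (b j k)) ((a j).mul (b i k)),
      pd_mul' m _ _ (a i) (b j k), pd_mul' m _ _ (a j) (b i k), pd_mul' m _ _ (a k) (b i j)]
  unfold d3c
  simp only [key]
  simp only [w22, w13, d1, d2]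
  ring

theorem pd_d2 (B : Form2) (hB : ContDiff ℝ (⊤ : ℕ∞) B) (x : Pt) (m i j k : Fin 4) :
    pd m (fun y => d2 B y i j k) x = pd m (fun y => pd i (fun z => B z j k) y) x
      - pd m (fun y => pd j (fun z => B z i k) y) x
      + pd m (fun y => pd k (fun z => B z i j) y) x := by
  have b : ∀ n i j, Differentiable ℝ (fun y => pd n (fun z => B z i j) y) :=
    fun n i j => smooth_diff _ (pd_smooth n _ (c2 B hB i j))
  unfold d2
  rw [pd_add' m (fun y => pd i (fun z => B z j k) y - pd j (fun z => B z i k) y) _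
    ((b i j k).sub (b j i k)) (b k i j), pd_sub' m _ _ (b i j k) (b j i k)]

theorem d2_diff (B : Form2) (hB : ContDiff ℝ (⊤ : ℕ∞) B) (i j k : Fin 4) :
    Differentiable ℝ (fun y => d2 B y i j k) := by
  have b : ∀ n i j, Differentiable ℝ (fun y => pd n (fun z => B z i j) y) :=
    fun n i j => smooth_diff _ (pd_smooth n _ (c2 B hB i j))
  exact ((b i j k).sub (b j i k)).add (b k i j)

theorem d3c_d2 (B : Form2) (hB : ContDiff ℝ (⊤ : ℕ∞) B) (x : Pt) : d3c (d2 B) x = 0 := by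
  unfold d3c
  simp only [pd_d2 B hB]
  rw [pd_comm' 1 0 _ (c2 B hB 2 3), pd_comm' 2 0 _ (c2 B hB 1 3), pd_comm' 3 0 _ (c2 B hB 1 2),
    pd_comm' 2 1 _ (c2 B hB 0 3), pd_comm' 3 1 _ (c2 B hB 0 2), pd_comm' 3 2 _ (c2 B hB 0 1)]
  ring

theorem d2_d1 (α : Form1) (h : ContDiff ℝ (⊤ : ℕ∞) α) (x : Pt) (i j k : Fin 4) :
    d2 (d1 α) x i j k = 0 := by
  have b : ∀ n i, Differentiable ℝ (fun y => pd n (fun z => α z i) y) :=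
    fun n i => smooth_diff _ (pd_smooth n _ (c1 α h i))
  unfold d2 d1
  rw [pd_sub' i _ _ (b j k) (b k j), pd_sub' j _ _ (b i k) (b k i), pd_sub' k _ _ (b i j) (b j i),
    pd_comm' j i _ (c1 α h k), pd_comm' k i _ (c1 α h j), pd_comm' k j _ (c1 α h i)]
  ring

theorem d3c_smul (f : Form0) (C : Form3) (hf : Differentiable ℝ f)
    (hC : ∀ i j k, Differentiable ℝ (fun y => C y i j k)) (x : Pt) :
    d3c (fun y i j k => f y * C y i j k) x = w13 (d0 f) C x 0 1 2 3 + f x * d3c C x := by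
  unfold d3c
  rw [pd_mul' 0 _ _ hf (hC 1 2 3), pd_mul' 1 _ _ hf (hC 0 2 3), pd_mul' 2 _ _ hf (hC 0 1 3),
    pd_mul' 3 _ _ hf (hC 0 1 2)]
  simp only [w13, d0]
  ring

theorem d3c_neg (C : Form3) (x : Pt) : d3c (fun y i j k => - C y i j k) x = - d3c C x := by
  unfold d3c
  simp only [pd_neg']
  ring

theorem skew_vals (A : Fin 4 → Fin 4 → ℝ) (h : ∀ i j, A i j = - A j i) :
    (∀ i, A i i = 0) ∧ A 1 0 = - A 0 1 ∧ A 2 0 = - A 0 2 ∧ A 3 0 = - A 0 3 ∧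
      A 2 1 = - A 1 2 ∧ A 3 1 = - A 1 3 ∧ A 3 2 = - A 2 3 :=
  ⟨fun i => by linarith [h i i], h _ _, h _ _, h _ _, h _ _, h _ _, h _ _⟩

/-- Every component of a wedge product of 2-forms is a universal multiple of the `0123` one. -/
theorem w22_comp (i j k l : Fin 4) : ∃ c : ℝ, ∀ (A B : Form2), Alt2 A → Alt2 B → ∀ x,
    w22 A B x i j k l = c * w22 A B x 0 1 2 3 := by
  have go : ∀ c : ℝ, (∀ (A B : Fin 4 → Fin 4 → ℝ), (∀ i, A i i = 0) → (∀ i, B i i = 0) →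
      A 1 0 = - A 0 1 → A 2 0 = - A 0 2 → A 3 0 = - A 0 3 →
      A 2 1 = - A 1 2 → A 3 1 = - A 1 3 → A 3 2 = - A 2 3 →
      B 1 0 = - B 0 1 → B 2 0 = - B 0 2 → B 3 0 = - B 0 3 →
      B 2 1 = - B 1 2 → B 3 1 = - B 1 3 → B 3 2 = - B 2 3 →
      A i j * B k l - A i k * B j l + A i l * B j k
        + A j k * B i l - A j l * B i k + A k l * B i j =
      c * (A 0 1 * B 2 3 - A 0 2 * B 1 3 + A 0 3 * B 1 2
        + A 1 2 * B 0 3 - A 1 3 * B 0 2 + A 2 3 * B 0 1)) →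
      ∃ c : ℝ, ∀ (A B : Form2), Alt2 A → Alt2 B → ∀ x,
        w22 A B x i j k l = c * w22 A B x 0 1 2 3 := by
    intro c h
    refine ⟨c, fun A B hA hB x => ?_⟩
    obtain ⟨a0, a1, a2, a3, a4, a5, a6⟩ := skew_vals (A x) (hA x)
    obtain ⟨b0, b1, b2, b3, b4, b5, b6⟩ := skew_vals (B x) (hB x)
    exact h _ _ a0 b0 a1 a2 a3 a4 a5 a6 b1 b2 b3 b4 b5 b6
  fin_cases i <;> fin_cases j <;> fin_cases k <;> fin_cases l <;>
  first
  | (refine go 0 ?_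
     intro A B a0 b0 a1 a2 a3 a4 a5 a6 b1 b2 b3 b4 b5 b6
     simp only [Fin.mk_zero, Fin.mk_one, Fin.reduceFinMk, Fin.zero_eta, a0, b0, a1, a2, a3, a4, a5, a6, b1, b2, b3, b4, b5, b6]
     ring; done)
  | (refine go 1 ?_
     intro A B a0 b0 a1 a2 a3 a4 a5 a6 b1 b2 b3 b4 b5 b6
     simp only [Fin.mk_zero, Fin.mk_one, Fin.reduceFinMk, Fin.zero_eta, a0, b0, a1, a2, a3, a4, a5, a6, b1, b2, b3, b4, b5, b6]
     ring; done)
  | (refine go (-1) ?_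
     intro A B a0 b0 a1 a2 a3 a4 a5 a6 b1 b2 b3 b4 b5 b6
     simp only [Fin.mk_zero, Fin.mk_one, Fin.reduceFinMk, Fin.zero_eta, a0, b0, a1, a2, a3, a4, a5, a6, b1, b2, b3, b4, b5, b6]
     ring; done)

theorem d1_alt (α : Form1) : Alt2 (d1 α) := fun x i j => by unfold d1; ring

/-- `i_Z (A ∧ A) = 2 (i_Z A) ∧ A`. -/
theorem contract_sq (Z : Vec) (A : Form2) (x : Pt) (j k l : Fin 4) :
    ∑ i, Z x i * w22 A A x i j k l = 2 * w12 (i2 Z A) A x j k l := by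
  simp only [w22, w12, i2, Fin.sum_univ_four]
  ring

/-- `i_Z (A ∧ B) = (i_Z A) ∧ B + (i_Z B) ∧ A`. -/
theorem contract_mul (Z : Vec) (A B : Form2) (x : Pt) (j k l : Fin 4) :
    ∑ i, Z x i * w22 A B x i j k l = w12 (i2 Z A) B x j k l + w12 (i2 Z B) A x j k l := by
  simp only [w22, w12, i2, Fin.sum_univ_four]
  ring

/-- Wedging with a form of rank 4 is injective on 1-forms. -/
theorem w12_inj (B : Form2) (hB : Alt2 B) (x : Pt) (hp : w22 B B x 0 1 2 3 ≠ 0) (α : Form1)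
    (h : ∀ i j k, w12 α B x i j k = 0) (i : Fin 4) : α x i = 0 := by
  obtain ⟨a0, a1, a2, a3, a4, a5, a6⟩ := skew_vals (B x) (hB x)
  have h1 := h 0 1 2
  have h2 := h 0 1 3
  have h3 := h 0 2 3
  have h4 := h 1 2 3
  simp only [w12] at h1 h2 h3 h4
  have : α x i * w22 B B x 0 1 2 3 = 0 := by
    simp only [w22]
    fin_cases i
    · show α x 0 * _ = 0
      linear_combination 2 * B x 0 3 * h1 - 2 * B x 0 2 * h2 + 2 * B x 0 1 * h3
    · show α x 1 * _ = 0
      linear_combination 2 * B x 1 3 * h1 - 2 * B x 1 2 * h2 + 2 * B x 0 1 * h4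
    · show α x 2 * _ = 0
      linear_combination 2 * B x 2 3 * h1 - 2 * B x 1 2 * h3 + 2 * B x 0 2 * h4
    · show α x 3 * _ = 0
      linear_combination 2 * B x 2 3 * h2 - 2 * B x 1 3 * h3 + 2 * B x 0 3 * h4
  exact (mul_eq_zero.1 this).resolve_right hp

/-- `Z(f) B ∧ B = 2 df ∧ (i_Z B) ∧ B`. -/
theorem dir_formula (Z : Vec) (f : Form0) (B : Form2) (hB : Alt2 B) (x : Pt) :
    dirDeriv Z f x * w22 B B x 0 1 2 3
      = 2 * w13 (d0 f) (w12 (i2 Z B) B) x 0 1 2 3 := by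
  obtain ⟨a0, a1, a2, a3, a4, a5, a6⟩ := skew_vals (B x) (hB x)
  simp only [dirDeriv, w22, w13, w12, i2, d0, Fin.sum_univ_four, a0, a1, a2, a3, a4, a5, a6]
  ring

/-- formula (5) of Proposition `ZandT`. If moreover `dΩ ≠ 0`, then
`dω_Ω ∧ dφ_Ω = −(1/2)·Z_Ω(I(Ω))·Ω∧Ω`. -/
theorem ZandT_formula1 (Ω : Form2) (hΩs : ContDiff ℝ (⊤ : ℕ∞) Ω) (hΩa : Alt2 Ω)
    (hΩr : Rank4 Ω)
    (ω : Form1) (hωs : ContDiff ℝ (⊤ : ℕ∞) ω) (hω : ∀ x, w12 ω Ω x = d2 Ω x)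
    (θ : Form1) (hθs : ContDiff ℝ (⊤ : ℕ∞) θ) (hθ : ∀ x, w12 θ Ω x = w12 ω (d1 ω) x)
    (Z : Vec) (hZs : ContDiff ℝ (⊤ : ℕ∞) Z) (hZ : ∀ x, i2 Z Ω x = ω x)
    (I : Form0) (hIs : ContDiff ℝ (⊤ : ℕ∞) I)
    (hI : ∀ x i j k l, I x * w22 Ω Ω x i j k l = w22 (d1 ω) (d1 ω) x i j k l)
    (hdΩ : ∀ x, d2 Ω x ≠ 0) :
    ∀ x i j k l, w22 (d1 ω) (d1 θ) x i j k l
      = -(1 / 2) * dirDeriv Z I x * w22 Ω Ω x i j k l := by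
  have hp : ∀ x, w22 Ω Ω x 0 1 2 3 ≠ 0 := by
    intro x h
    apply hΩr x
    funext i j k l
    obtain ⟨c, hc⟩ := w22_comp i j k l
    rw [hc Ω Ω hΩa hΩa x, h]; simp
  have hZ' : i2 Z Ω = ω := funext hZ
  have hω' : w12 ω Ω = d2 Ω := funext hω
  have hds := d1_smooth ω hωs
  -- `dω ∧ Ω = 0`
  have s1 : ∀ x, w22 (d1 ω) Ω x 0 1 2 3 = 0 := by
    intro x
    have h := d3c_w12 ω Ω hωs hΩs x
    rw [hω', d3c_d2 Ω hΩs, ← hω'] at h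
    have h0 : w13 ω (w12 ω Ω) x 0 1 2 3 = 0 := by simp only [w13, w12]; ring
    linarith
  have s1' : ∀ x i j k l, w22 (d1 ω) Ω x i j k l = 0 := by
    intro x i j k l
    obtain ⟨c, hc⟩ := w22_comp i j k l
    rw [hc _ _ (d1_alt ω) hΩa x, s1]; simp
  -- `i_Z dω = - θ`
  have s2 : ∀ x i, i2 Z (d1 ω) x i = - θ x i := by
    intro x i
    have h := w12_inj Ω hΩa x (hp x) (fun y m => θ y m + i2 Z (d1 ω) y m) (by
      intro i j k
      have e1 := contract_mul Z (d1 ω) Ω x i j k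
      simp only [s1', mul_zero, Finset.sum_const_zero] at e1
      rw [hZ'] at e1
      have e2 := congrFun (congrFun (congrFun (hθ x) i) j) k
      simp only [w12] at e1 e2 ⊢
      linarith) i
    linarith
  -- `I ω ∧ Ω = - θ ∧ dω`
  have s3 : (fun y i j k => I y * d2 Ω y i j k) = fun y i j k => - w12 θ (d1 ω) y i j k := by
    funext x j k l
    have e1 := contract_sq Z Ω x j k l
    have e2 := contract_sq Z (d1 ω) x j k l
    rw [hZ', hω'] at e1
    simp only [← hI] at e2
    have e3 : ∑ i, Z x i * (I x * w22 Ω Ω x i j k l)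
        = I x * ∑ i, Z x i * w22 Ω Ω x i j k l := by
      rw [Finset.mul_sum]; exact Finset.sum_congr rfl fun i _ => by ring
    rw [e3, e1] at e2
    simp only [w12, s2] at e2 ⊢
    linarith
  have s4 : ∀ x, w22 (d1 ω) (d1 θ) x 0 1 2 3
      = -(1 / 2) * dirDeriv Z I x * w22 Ω Ω x 0 1 2 3 := by
    intro x
    have e1 := d3c_smul I (d2 Ω) (smooth_diff I hIs) (d2_diff Ω hΩs) x
    rw [s3, d3c_neg, d3c_w12 θ (d1 ω) hθs hds, d3c_d2 Ω hΩs] at e1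
    have e2 : w13 θ (d2 (d1 ω)) x 0 1 2 3 = 0 := by simp only [w13, d2_d1 ω hωs]; ring
    have e3 := dir_formula Z I Ω hΩa x
    rw [hZ', hω'] at e3
    have e4 : w22 (d1 ω) (d1 θ) x 0 1 2 3 = w22 (d1 θ) (d1 ω) x 0 1 2 3 := by
      simp only [w22]; ring
    linarith
  intro x i j k l
  obtain ⟨c, hc⟩ := w22_comp i j k l
  rw [hc _ _ (d1_alt ω) (d1_alt θ), hc _ _ hΩa hΩa, s4]
  ring
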